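/- Let p be an odd prime, n a positive integer, and σ_ω a cyclic supercharacter modulo pn, where ω is a unit modulo pn with reductions ω_p modulo p and ω_n modulo n. Suppose ord(ω_n) = uv with gcd(v, ord(ω_p)) = 1, that u is even and v is odd, that ω_n^{uv/2} = −1 in ℤ/nℤ, and that ord(ω_p) = (p − 1)/r for a positive integer r. Let t be an integer coprime to p and s any integer. If 4 divides u and p ≡ 1 + ru/2 (mod ru), then σ_ω(sp + tn) = (4/(ru))·Σ_{j=1}^{u/2} [ Re(g_{ru/2}(ω^j t)) − 1 + i·Im(g_{ru/2}(ω^j t)) ]·Re(σ_{ω_n^u}(ω^j s)), where the arguments ω^j t of the Gauss sums are taken modulo p and σ_{ω_n^u} is the cyclic supercharacter modulo n attached to ω_n^u. -/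

import Mathlib

open Finset Pointwise

/-- `e(θ) = exp(2πiθ)`. -/
noncomputable def e2 (θ : ℝ) : ℂ := Complex.exp (2 * Real.pi * Complex.I * θ)

/-- The cyclic supercharacter `σ_ω : ℤ/nℤ → ℂ` attached to a unit `ω` mod `n`:
`σ_ω(y) = ∑_{j=1}^{d} e(ω^j y / n)` where `d` is the multiplicative order of `ω`. -/
noncomputable def cyclicSuperchar (n : ℕ) (ω : (ZMod n)ˣ) (y : ZMod n) : ℂ :=
  ∑ j ∈ Finset.Icc 1 (orderOf ω),
    e2 (((((ω ^ j : (ZMod n)ˣ) : ZMod n) * y).val : ℝ) / (n : ℝ))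

/-- `H m`: the set of traces of matrices in `SU_m(ℂ)` (the filled `m`-cusped hypocycloid). -/
noncomputable def H (m : ℕ) : Set ℂ :=
  Set.range fun M : Matrix.specialUnitaryGroup (Fin m) ℂ =>
    Matrix.trace (M : Matrix (Fin m) (Fin m) ℂ)

/-- `P m`: the convex hull of `H m` (the filled regular `m`-gon). -/
noncomputable def Pset (m : ℕ) : Set ℂ := convexHull ℝ (H m)

/-- `c_{j,k}` : the coefficient of `x^j` in the remainder of `x^k` mod `Φ_d(x)`. -/
noncomputable def cExp (d j k : ℕ) : ℤ :=
  (((Polynomial.X : Polynomial ℤ) ^ k) %ₘ Polynomial.cyclotomic d ℤ).coeff j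

/-- The Laurent-polynomial map `g_d(z_1,…,z_{φ(d)}) = ∑_{k=1}^d ∏_j z_j^{c_{j,k}}`. -/
noncomputable def gphi (d : ℕ) (z : Fin (Nat.totient d) → ℂ) : ℂ :=
  ∑ k ∈ Finset.Icc 1 d, ∏ j : Fin (Nat.totient d), z j ^ (cExp d (j : ℕ) k)

/-- The image of `g_d` restricted to the torus `𝕋^{φ(d)}`. -/
noncomputable def gImage (d : ℕ) : Set ℂ :=
  {w : ℂ | ∃ z : Fin (Nat.totient d) → ℂ, (∀ j, ‖z j‖ = 1) ∧ gphi d z = w}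

/-- The `k`-fold Minkowski sum `A^{⊕k}` of a subset of `ℂ` with itself. -/
def minkSumPow (A : Set ℂ) (k : ℕ) : Set ℂ :=
  {z : ℂ | ∃ f : Fin k → ℂ, (∀ i, f i ∈ A) ∧ ∑ i, f i = z}

/-- Scaling a subset of `ℂ` by a real number. -/
def scale (r : ℝ) (A : Set ℂ) : Set ℂ := (fun z => (r : ℂ) * z) '' A

/-- The sets `A k` fill out `B` as `k → ∞`. -/
def FillsOut (A : ℕ → Set ℂ) (B : Set ℂ) : Prop :=
  (∀ k, A k ⊆ B) ∧
    ∀ U : Set ℂ, IsOpen U → U.Nonempty → U ⊆ B → ∃ K : ℕ, ∀ k > K, (U ∩ A k).Nonempty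

/-- A subset of `ℂ` has `k`-fold dihedral symmetry if it is stable under complex
conjugation and under rotation by `2π/k` about the origin. -/
def HasDihedralSymm (k : ℕ) (A : Set ℂ) : Prop :=
  (∀ z ∈ A, (starRingEnd ℂ) z ∈ A) ∧ ∀ z ∈ A, e2 (1 / k) * z ∈ A

/-- The `k`-fold dihedral closure of a subset of `ℂ`. -/
def dihedralClosure (k : ℕ) (A : Set ℂ) : Set ℂ :=
  ⋂₀ {B : Set ℂ | A ⊆ B ∧ HasDihedralSymm k B}

/-- The Gauss sum `g_k(t) = ∑_{j=1}^{p} e(t j^k / p)` of order `k` mod `p`. -/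
noncomputable def gaussG (p k : ℕ) (t : ZMod p) : ℂ :=
  ∑ j ∈ Finset.Icc 1 p, e2 ((((t * (j : ZMod p) ^ k).val : ℕ) : ℝ) / (p : ℝ))

/-- The Gauss sum `G(t,χ) = ∑_{j=1}^{p-1} χ(j) e(tj/p)` attached to a character `χ` mod `p`. -/
noncomputable def GSum (p : ℕ) (χ : DirichletCharacter ℂ p) (t : ZMod p) : ℂ :=
  ∑ j ∈ Finset.Icc 1 (p - 1), χ (j : ZMod p) * e2 ((((t * (j : ZMod p)).val : ℕ) : ℝ) / (p : ℝ))

/-! ### The additive character of `ZMod n` -/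

lemma e2_val_div {n : ℕ} [NeZero n] (x : ZMod n) :
    e2 ((x.val : ℝ) / (n : ℝ)) = ZMod.stdAddChar x := by
  have h := ZMod.stdAddChar_coe (N := n) (x.val : ℤ)
  rw [Int.cast_natCast, ZMod.natCast_zmod_val] at h
  rw [h, e2]
  congr 1
  push_cast
  ring

lemma stdAddChar_neg_eq_conj {n : ℕ} [NeZero n] (x : ZMod n) :
    ZMod.stdAddChar (-x) = (starRingEnd ℂ) (ZMod.stdAddChar x) :=
  AddChar.map_neg_eq_conj _ _

lemma stdAddChar_mul_linearComb (m n : ℕ) [NeZero m] [NeZero n] (z s t : ℤ) :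
    (ZMod.stdAddChar ((z * (s * m + t * n) : ℤ) : ZMod (m * n)) : ℂ) =
      ZMod.stdAddChar ((z * t : ℤ) : ZMod m) * ZMod.stdAddChar ((z * s : ℤ) : ZMod n) := by
  rw [ZMod.stdAddChar_coe, ZMod.stdAddChar_coe, ZMod.stdAddChar_coe, ← Complex.exp_add]
  congr 1
  have hm : (m : ℂ) ≠ 0 := Nat.cast_ne_zero.2 (NeZero.ne m)
  have hn : (n : ℂ) ≠ 0 := Nat.cast_ne_zero.2 (NeZero.ne n)
  push_cast
  field_simp
  ring

/-! ### Sums over ranges -/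

lemma sum_Icc_one_eq_sum_range {M : Type*} [AddCommGroup M] {f : ℕ → M} {N : ℕ}
    (h : f N = f 0) : ∑ j ∈ Icc 1 N, f j = ∑ j ∈ range N, f j := by
  rw [← Finset.Ico_add_one_right_eq_Icc, Finset.sum_Ico_eq_sub _ (Nat.le_add_left 1 N),
    Finset.sum_range_succ, h, Finset.sum_range_one, add_sub_cancel_right]

lemma sum_range_mul_eq {M : Type*} [AddCommMonoid M] (f : ℕ → M) (a b : ℕ) :
    ∑ j ∈ range (a * b), f j = ∑ i ∈ range a, ∑ k ∈ range b, f (i + a * k) := by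
  rw [Finset.sum_comm]
  induction b with
  | zero => simp
  | succ b ih =>
    rw [Nat.mul_succ, Finset.sum_range_add, ih, Finset.sum_range_succ]
    simp only [add_comm]

lemma sum_range_mul_of_coprime {R : Type*} [CommSemiring R] {a b : ℕ} (ha : a ≠ 0) (hb : b ≠ 0)
    (hab : a.Coprime b) {f g : ℕ → R} (hf : f.Periodic a) (hg : g.Periodic b) :
    ∑ j ∈ range (a * b), f j * g j = (∑ j ∈ range a, f j) * ∑ j ∈ range b, g j := by
  rw [Finset.sum_mul_sum, ← Finset.sum_product']
  refine Finset.sum_bij' (fun j _ => (j % a, j % b))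
    (fun x _ => (Nat.chineseRemainder hab x.1 x.2 : ℕ)) ?_ ?_ ?_ ?_ ?_
  · intro j _
    simp [Nat.mod_lt, Nat.pos_of_ne_zero ha, Nat.pos_of_ne_zero hb]
  · intro x _
    exact Finset.mem_range.2 (Nat.chineseRemainder_lt_mul hab _ _ ha hb)
  · intro j hj
    have h := Nat.chineseRemainder_modEq_unique hab (Nat.mod_modEq j a).symm (Nat.mod_modEq j b).symm
    exact (Nat.ModEq.eq_of_lt_of_lt h (Finset.mem_range.1 hj)
      (Nat.chineseRemainder_lt_mul hab _ _ ha hb)).symm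
  · rintro ⟨x, y⟩ hxy
    simp only [Finset.mem_product, Finset.mem_range] at hxy
    obtain ⟨h₁, h₂⟩ := (Nat.chineseRemainder hab x y).2
    exact Prod.ext (Nat.mod_eq_of_modEq h₁ hxy.1) (Nat.mod_eq_of_modEq h₂ hxy.2)
  · intro j _
    simp only [hf.map_mod_nat, hg.map_mod_nat]

lemma sum_univ_zpowers {G M : Type*} [Group G] [Fintype G] [AddCommMonoid M] (x : G)
    [Fintype (Subgroup.zpowers x)] (f : G → M) :
    ∑ y : Subgroup.zpowers x, f y = ∑ j ∈ range (orderOf x), f (x ^ j) := by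
  rw [Finset.sum_range]
  exact (Fintype.sum_equiv (finEquivZPowers (isOfFinOrder_of_finite x)) _ _
    fun _ => rfl).symm

/-! ### Cyclic supercharacters -/

lemma cyclicSuperchar_eq_sum_range {n : ℕ} [NeZero n] (ω : (ZMod n)ˣ) (y : ZMod n) :
    cyclicSuperchar n ω y =
      ∑ j ∈ range (orderOf ω), ZMod.stdAddChar (((ω ^ j : (ZMod n)ˣ) : ZMod n) * y) := by
  simp only [cyclicSuperchar, e2_val_div]
  exact sum_Icc_one_eq_sum_range (by rw [pow_orderOf_eq_one, pow_zero])

lemma cyclicSuperchar_eq_sum_zpowers {n : ℕ} [NeZero n] (ω : (ZMod n)ˣ)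
    [Fintype (Subgroup.zpowers ω)] (y : ZMod n) :
    cyclicSuperchar n ω y =
      ∑ x : Subgroup.zpowers ω, ZMod.stdAddChar (((x : (ZMod n)ˣ) : ZMod n) * y) := by
  rw [cyclicSuperchar_eq_sum_range,
    sum_univ_zpowers ω fun x : (ZMod n)ˣ => (ZMod.stdAddChar ((x : ZMod n) * y) : ℂ)]

lemma cyclicSuperchar_mul_of_mem {n : ℕ} [NeZero n] {ω x : (ZMod n)ˣ}
    (hx : x ∈ Subgroup.zpowers ω) (y : ZMod n) :
    cyclicSuperchar n ω (x * y) = cyclicSuperchar n ω y := by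
  classical
  simp only [cyclicSuperchar_eq_sum_zpowers]
  refine Fintype.sum_equiv (Equiv.mulRight (⟨x, hx⟩ : Subgroup.zpowers ω)) _ _ fun z => ?_
  simp [mul_assoc]

lemma cyclicSuperchar_neg {n : ℕ} [NeZero n] (ω : (ZMod n)ˣ) (y : ZMod n) :
    cyclicSuperchar n ω (-y) = (starRingEnd ℂ) (cyclicSuperchar n ω y) := by
  simp only [cyclicSuperchar_eq_sum_range, map_sum, mul_neg, stdAddChar_neg_eq_conj]

/-! ### Gauss sums -/

lemma MonoidHom.sum_comp_eq_card_ker_mul {G H R : Type*} [Group G] [Fintype G] [Group H]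
    [Semiring R] (φ : G →* H) [Fintype φ.range] (f : H → R) :
    ∑ x, f (φ x) = (Nat.card φ.ker : R) * ∑ y : φ.range, f y := by
  classical
  rw [← Fintype.sum_fiberwise φ.rangeRestrict, Finset.mul_sum]
  refine Finset.sum_congr rfl fun y _ => ?_
  have hcard : Fintype.card {x // φ.rangeRestrict x = y} = Nat.card φ.ker := by
    rw [← φ.ker_rangeRestrict, Fintype.card_subtype, MonoidHom.card_fiber_eq_of_mem_range
      φ.rangeRestrict (φ.rangeRestrict_surjective y) (φ.rangeRestrict_surjective 1),
      ← Fintype.card_subtype, ← Nat.card_eq_fintype_card]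
    rfl
  rw [← hcard, ← nsmul_eq_mul, ← Finset.card_univ, ← Finset.sum_const]
  refine Finset.sum_congr rfl fun x _ => ?_
  exact congrArg (fun z : φ.range => f z) x.2

lemma IsCyclic.range_powMonoidHom_eq_zpowers {G : Type*} [CommGroup G] [IsCyclic G] [Finite G]
    {k : ℕ} (x : G) (h : k * orderOf x = Nat.card G) :
    (powMonoidHom k : G →* G).range = Subgroup.zpowers x := by
  have hk : k ≠ 0 := by rintro rfl; exact Nat.card_pos.ne (by rwa [zero_mul] at h)
  have hker : Nat.card (powMonoidHom (orderOf x) : G →* G).ker = orderOf x := by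
    rw [IsCyclic.card_powMonoidHom_ker, ← h, Nat.gcd_eq_right (Dvd.intro_left _ rfl)]
  trans (powMonoidHom (orderOf x) : G →* G).ker
  · refine Subgroup.eq_of_le_of_card_ge ?_ ?_
    · rintro _ ⟨y, rfl⟩
      simp [MonoidHom.mem_ker, ← pow_mul, h]
    · rw [hker, IsCyclic.card_powMonoidHom_range, ← h, Nat.gcd_eq_right (Dvd.intro _ rfl),
        Nat.mul_div_cancel_left _ (Nat.pos_of_ne_zero hk)]
  · symm
    refine Subgroup.eq_of_le_of_card_ge ?_ ?_
    · rw [Subgroup.zpowers_le]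
      simp [MonoidHom.mem_ker, pow_orderOf_eq_one]
    · rw [hker, Nat.card_zpowers]

lemma gaussG_eq_sum {p : ℕ} [NeZero p] (k : ℕ) (t : ZMod p) :
    gaussG p k t = ∑ x : ZMod p, ZMod.stdAddChar (t * x ^ k) := by
  simp only [gaussG, e2_val_div]
  rw [sum_Icc_one_eq_sum_range (by rw [CharP.cast_eq_zero (ZMod p) p, Nat.cast_zero])]
  refine Finset.sum_bij' (fun j _ => (j : ZMod p)) (fun x _ => x.val) ?_ ?_ ?_ ?_ ?_
  · simp
  · intro x _
    exact Finset.mem_range.2 x.val_lt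
  · intro j hj
    exact ZMod.val_cast_of_lt (Finset.mem_range.1 hj)
  · simp
  · simp

lemma gaussG_eq_one_add {p : ℕ} [Fact p.Prime] {k : ℕ} (x : (ZMod p)ˣ)
    (h : k * orderOf x = p - 1) (t : ZMod p) :
    gaussG p k t = 1 + k * cyclicSuperchar p x t := by
  classical
  have hp1 : p - 1 ≠ 0 := by have := (Fact.out : p.Prime).two_le; omega
  have hk : k ≠ 0 := by rintro rfl; simp at h; omega
  have hcard : Nat.card (ZMod p)ˣ = p - 1 := by
    rw [Nat.card_eq_fintype_card, ZMod.card_units]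
  have hrange := IsCyclic.range_powMonoidHom_eq_zpowers x (h.trans hcard.symm)
  have hker : Nat.card (powMonoidHom k : (ZMod p)ˣ →* (ZMod p)ˣ).ker = k := by
    rw [IsCyclic.card_powMonoidHom_ker, hcard, ← h, Nat.gcd_eq_right (Dvd.intro _ rfl)]
  have hsum := MonoidHom.sum_comp_eq_card_ker_mul (powMonoidHom k : (ZMod p)ˣ →* (ZMod p)ˣ)
    fun y => (ZMod.stdAddChar ((y : ZMod p) * t) : ℂ)
  rw [hker] at hsum
  rw [gaussG_eq_sum, cyclicSuperchar_eq_sum_zpowers]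
  have hcongr : ∑ y : (powMonoidHom k : (ZMod p)ˣ →* (ZMod p)ˣ).range,
      (ZMod.stdAddChar (((y : (ZMod p)ˣ) : ZMod p) * t) : ℂ) =
      ∑ y : Subgroup.zpowers x, ZMod.stdAddChar (((y : (ZMod p)ˣ) : ZMod p) * t) :=
    Fintype.sum_equiv (MulEquiv.subgroupCongr hrange).toEquiv _ _ fun _ => rfl
  rw [← hcongr, ← hsum, Fintype.sum_eq_add_sum_subtype_ne _ 0,
    ← Fintype.sum_equiv unitsEquivNeZero _ _ fun _ => rfl]
  simp [hk, mul_comm t]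

/-! ### Orders of units -/

lemma orderOf_eq_lcm_of_coprime {m n : ℕ} (h : m.Coprime n) (ω : (ZMod (m * n))ˣ) :
    orderOf ω = (orderOf (ZMod.unitsMap (dvd_mul_right m n) ω)).lcm
      (orderOf (ZMod.unitsMap (dvd_mul_left n m) ω)) := by
  refine Nat.dvd_antisymm ?_ (Nat.lcm_dvd (orderOf_map_dvd _ _) (orderOf_map_dvd _ _))
  rw [orderOf_dvd_iff_pow_eq_one]
  have h₁ := orderOf_dvd_iff_pow_eq_one.1 (Nat.dvd_lcm_left
    (orderOf (ZMod.unitsMap (dvd_mul_right m n) ω)) (orderOf (ZMod.unitsMap (dvd_mul_left n m) ω)))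
  have h₂ := orderOf_dvd_iff_pow_eq_one.1 (Nat.dvd_lcm_right
    (orderOf (ZMod.unitsMap (dvd_mul_right m n) ω)) (orderOf (ZMod.unitsMap (dvd_mul_left n m) ω)))
  rw [← map_pow] at h₁ h₂
  refine Units.ext ((ZMod.chineseRemainder h).injective ?_)
  rw [Units.val_one, map_one]
  exact Prod.ext ((Prod.fst_zmod_cast _).trans (congrArg Units.val h₁))
    ((Prod.snd_zmod_cast _).trans (congrArg Units.val h₂))

/-! ### Factoring a supercharacter modulo `p * n` -/

lemma stdAddChar_mul_eq_mul_unitsMap {m n : ℕ} [NeZero m] [NeZero n] (ω : (ZMod (m * n))ˣ)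
    (s t : ℤ) :
    (ZMod.stdAddChar ((ω : ZMod (m * n)) * ((s * m + t * n : ℤ) : ZMod (m * n))) : ℂ) =
      ZMod.stdAddChar ((ZMod.unitsMap (dvd_mul_right m n) ω : ZMod m) * (t : ZMod m)) *
        ZMod.stdAddChar ((ZMod.unitsMap (dvd_mul_left n m) ω : ZMod n) * (s : ZMod n)) := by
  obtain ⟨z, hz⟩ := ZMod.intCast_surjective (ω : ZMod (m * n))
  have h₁ : (ZMod.unitsMap (dvd_mul_right m n) ω : ZMod m) = z := by
    rw [ZMod.unitsMap_val, ← hz, ZMod.cast_intCast (dvd_mul_right m n)]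
  have h₂ : (ZMod.unitsMap (dvd_mul_left n m) ω : ZMod n) = z := by
    rw [ZMod.unitsMap_val, ← hz, ZMod.cast_intCast (dvd_mul_left n m)]
  rw [h₁, h₂, ← hz, ← Int.cast_mul, ← Int.cast_mul, ← Int.cast_mul, stdAddChar_mul_linearComb]

lemma cyclicSuperchar_eq_sum_mul {m n u a b : ℕ} [NeZero m] [NeZero n] (ω : (ZMod (m * n))ˣ)
    (α : (ZMod m)ˣ) (hα : α = ZMod.unitsMap (dvd_mul_right m n) ω)
    (β : (ZMod n)ˣ) (hβ : β = ZMod.unitsMap (dvd_mul_left n m) ω)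
    (hω : orderOf ω = u * (a * b)) (ha : orderOf (α ^ u) = a) (hb : orderOf (β ^ u) = b)
    (hab : a.Coprime b) (s t : ℤ) :
    cyclicSuperchar (m * n) ω ((s * m + t * n : ℤ) : ZMod (m * n)) =
      ∑ i ∈ range u, cyclicSuperchar m (α ^ u) ((α : ZMod m) ^ i * (t : ZMod m)) *
        cyclicSuperchar n (β ^ u) ((β : ZMod n) ^ i * (s : ZMod n)) := by
  have ha0 : a ≠ 0 := ha ▸ (orderOf_pos _).ne'
  have hb0 : b ≠ 0 := hb ▸ (orderOf_pos _).ne'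
  simp only [cyclicSuperchar_eq_sum_range, stdAddChar_mul_eq_mul_unitsMap, map_pow, ← hα, ← hβ]
  rw [hω, ha, hb, sum_range_mul_eq]
  refine Finset.sum_congr rfl fun i _ => ?_
  rw [← sum_range_mul_of_coprime ha0 hb0 hab]
  · refine Finset.sum_congr rfl fun k _ => ?_
    rw [add_comm i]
    simp only [pow_add, pow_mul, Units.val_mul, Units.val_pow_eq_pow_val, mul_assoc]
  · intro k
    dsimp only
    rw [pow_add, ← ha, pow_orderOf_eq_one, mul_one]
  · intro k
    dsimp only
    rw [pow_add, ← hb, pow_orderOf_eq_one, mul_one]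

lemma cyclicSuperchar_pow_mul_of_pow_eq_neg_one {n w v : ℕ} [NeZero n] {β : (ZMod n)ˣ}
    (hv : Odd v) (hβ : β ^ (w * v) = -1) (y : ZMod n) :
    cyclicSuperchar n (β ^ (2 * w)) ((β : ZMod n) ^ w * y) =
      (starRingEnd ℂ) (cyclicSuperchar n (β ^ (2 * w)) y) := by
  obtain ⟨c, rfl⟩ := hv
  have h : β ^ w = -(β ^ (2 * w)) ^ (c + 1) := by
    rw [← pow_mul, show 2 * w * (c + 1) = w * (2 * c + 1) + w by ring, pow_add, hβ, neg_one_mul,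
      neg_neg]
  rw [← cyclicSuperchar_neg, ← Units.val_pow_eq_pow_val, h, Units.val_neg, neg_mul, ← mul_neg,
    cyclicSuperchar_mul_of_mem (Subgroup.npow_mem_zpowers _ _)]

lemma cyclicSuperchar_pow_mul_of_orderOf_eq {m w q : ℕ} [NeZero m] {α : (ZMod m)ˣ}
    (hq : Odd q) (hα : orderOf α = w * q) (y : ZMod m) :
    cyclicSuperchar m (α ^ (2 * w)) ((α : ZMod m) ^ w * y) =
      cyclicSuperchar m (α ^ (2 * w)) y := by
  obtain ⟨c, rfl⟩ := hq
  have h : α ^ w = (α ^ (2 * w)) ^ (c + 1) := by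
    rw [← pow_mul, show 2 * w * (c + 1) = w * (2 * c + 1) + w by ring, pow_add, ← hα,
      pow_orderOf_eq_one, one_mul]
  rw [← Units.val_pow_eq_pow_val, h,
    cyclicSuperchar_mul_of_mem (Subgroup.npow_mem_zpowers _ _)]

lemma not_dvd_of_unitsMap_pow_eq_neg_one {p n w q v : ℕ} [Fact p.Prime] (hp : p ≠ 2)
    (ω : (ZMod (p * n))ˣ) (hq : Odd q)
    (h₁ : ZMod.unitsMap (dvd_mul_right p n) ω ^ (w * q) = 1)
    (h₂ : ZMod.unitsMap (dvd_mul_left n p) ω ^ (w * v) = -1) : ¬ p ∣ n := by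
  intro hpn
  have hmap : ZMod.unitsMap hpn (ZMod.unitsMap (dvd_mul_left n p) ω) =
      ZMod.unitsMap (dvd_mul_right p n) ω :=
    DFunLike.congr_fun (ZMod.unitsMap_comp hpn (dvd_mul_left n p)) ω
  have hneg : ZMod.unitsMap hpn (-1) = -1 := by
    ext
    simp [ZMod.unitsMap_def]
  have h := congrArg (ZMod.unitsMap hpn) h₂
  rw [map_pow, hmap, hneg] at h
  have h' := congrArg (· ^ q) h
  simp only [← pow_mul, hq.neg_one_pow] at h'
  rw [mul_right_comm, pow_mul, h₁, one_pow] at h'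
  have : Fact (2 < p) := ⟨lt_of_le_of_ne (Fact.out : p.Prime).two_le hp.symm⟩
  exact ZMod.neg_one_ne_one (congrArg Units.val h').symm

lemma exists_odd_sub_one_eq_mul {p a : ℕ} (hp : 1 < p) (h : p ≡ 1 + a [MOD 2 * a]) :
    ∃ q, Odd q ∧ p - 1 = a * q := by
  obtain ⟨c, hc⟩ := (Nat.modEq_iff_dvd).1 h
  push_cast at hc
  have hq : (p : ℤ) - 1 = a * (1 - 2 * c) := by linarith
  have hpos : 0 < 1 - 2 * c := by
    by_contra hneg
    have : (a : ℤ) * (1 - 2 * c) ≤ 0 :=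
      mul_nonpos_of_nonneg_of_nonpos (Int.natCast_nonneg a) (not_lt.1 hneg)
    omega
  refine ⟨(1 - 2 * c).toNat, ?_, ?_⟩
  · rw [← Int.odd_coe_nat, Int.toNat_of_nonneg hpos.le]
    exact ⟨-c, by ring⟩
  · zify [hp.le]
    rw [Int.toNat_of_nonneg hpos.le, hq]

/-- (Theorem `shapethm`(b).) With `σ_ω` a cyclic supercharacter mod `pn`,
`ord(ω_n) = uv`, `gcd(v, ord(ω_p)) = 1`, `u` even, `v` odd, `ω_n^{uv/2} = -1`,
`ord(ω_p) = (p-1)/r`, `t` coprime to `p`, `4 ∣ u`, and `p ≡ 1 + ru/2 (mod ru)`, one has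
`σ_ω(sp+tn) = (4/ru)·∑_{j=1}^{u/2} [Re g_{ru/2}(ω^j t) - 1
  + i·Im g_{ru/2}(ω^j t)]·Re σ_{ω_n^u}(ω^j s)`. -/
theorem stmt17 (p n : ℕ) (hp : p.Prime) (hpodd : Odd p) (hn : 0 < n)
    (ω : (ZMod (p * n))ˣ)
    (ωp : (ZMod p)ˣ) (hωp : ωp = ZMod.unitsMap (dvd_mul_right p n) ω)
    (ωn : (ZMod n)ˣ) (hωn : ωn = ZMod.unitsMap (dvd_mul_left n p) ω)
    (u v : ℕ) (hord : orderOf ωn = u * v) (hcop : Nat.Coprime v (orderOf ωp))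
    (hu : Even u) (hv : Odd v)
    (hneg : (ωn : ZMod n) ^ (u * v / 2) = -1)
    (r : ℕ) (hr : 0 < r) (hordp : orderOf ωp = (p - 1) / r)
    (t : ℤ) (ht : IsCoprime t (p : ℤ)) (s : ℤ)
    (hu4 : 4 ∣ u) (hmod : p ≡ 1 + r * u / 2 [MOD r * u]) :
    cyclicSuperchar (p * n) ω ((s * p + t * n : ℤ) : ZMod (p * n)) =
      (4 / ((r : ℂ) * u)) * ∑ j ∈ Finset.Icc 1 (u / 2),
        (((gaussG p (r * u / 2) ((ωp : ZMod p) ^ j * (t : ZMod p))).re : ℂ) - 1 +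
            Complex.I *
              ((gaussG p (r * u / 2) ((ωp : ZMod p) ^ j * (t : ZMod p))).im : ℂ)) *
          ((cyclicSuperchar n (ωn ^ u) ((ωn : ZMod n) ^ j * (s : ZMod n))).re : ℂ) := by
  have : Fact p.Prime := ⟨hp⟩
  have : NeZero n := ⟨hn.ne'⟩
  obtain ⟨w, rfl⟩ := hu.two_dvd
  have hw2 : 2 * w / 2 = w := by omega
  have hrw : r * (2 * w) / 2 = r * w := by
    rw [mul_left_comm, Nat.mul_div_cancel_left _ two_pos]
  have hwv : 2 * w * v / 2 = w * v := by
    rw [mul_assoc, Nat.mul_div_cancel_left _ two_pos]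
  rw [hrw, mul_left_comm] at hmod
  rw [hwv] at hneg
  simp only [hrw, hw2]
  have hβ : ωn ^ (w * v) = -1 := Units.ext (by simpa using hneg)
  obtain ⟨q, hq, hpq⟩ := exists_odd_sub_one_eq_mul hp.one_lt hmod
  have hα : orderOf ωp = w * q := by
    rw [hordp, hpq, mul_assoc, Nat.mul_div_cancel_left _ hr]
  have hw : 0 < w := Nat.pos_of_mul_pos_right (hα ▸ orderOf_pos ωp)
  have hvq : q.Coprime v := (hcop.coprime_dvd_right (hα ▸ Dvd.intro_left w rfl)).symm
  have hpn : p.Coprime n := by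
    rw [hp.coprime_iff_not_dvd]
    refine not_dvd_of_unitsMap_pow_eq_neg_one (by rintro rfl; exact absurd hpodd (by decide)) ω hq ?_
      (hωn ▸ hβ)
    rw [← hωp, ← hα, pow_orderOf_eq_one]
  have hω : orderOf ω = 2 * w * (q * v) := by
    have h2 : q.Coprime (2 * v) := hq.coprime_two_right.mul_right hvq
    rw [orderOf_eq_lcm_of_coprime hpn, ← hωp, ← hωn, hα, hord, mul_comm 2 w, mul_assoc w 2 v,
      Nat.lcm_mul_left, h2.lcm_eq_mul]
    ring
  have hαu : orderOf (ωp ^ (2 * w)) = q := by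
    rw [orderOf_pow, hα, mul_comm 2 w, Nat.gcd_mul_left, hq.coprime_two_right.gcd_eq_one, mul_one,
      Nat.mul_div_cancel_left _ hw]
  have hβu : orderOf (ωn ^ (2 * w)) = v := by
    rw [orderOf_pow_of_dvd (by omega) (hord ▸ Dvd.intro _ rfl), hord,
      Nat.mul_div_cancel_left _ (by omega)]
  have hgauss (y : ZMod p) : gaussG p (r * w) y =
      1 + ((r * w : ℕ) : ℂ) * cyclicSuperchar p (ωp ^ (2 * w)) y :=
    gaussG_eq_one_add _ (by rw [hαu, hpq]) y
  have hpair (i : ℕ) :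
      cyclicSuperchar p (ωp ^ (2 * w)) ((ωp : ZMod p) ^ (w + i) * (t : ZMod p)) =
        cyclicSuperchar p (ωp ^ (2 * w)) ((ωp : ZMod p) ^ i * (t : ZMod p)) := by
    rw [pow_add, mul_assoc, cyclicSuperchar_pow_mul_of_orderOf_eq hq hα]
  have hconj (i : ℕ) :
      cyclicSuperchar n (ωn ^ (2 * w)) ((ωn : ZMod n) ^ (w + i) * (s : ZMod n)) =
        (starRingEnd ℂ) (cyclicSuperchar n (ωn ^ (2 * w)) ((ωn : ZMod n) ^ i * (s : ZMod n))) := by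
    rw [pow_add, mul_assoc, cyclicSuperchar_pow_mul_of_pow_eq_neg_one hv hβ]
  rw [cyclicSuperchar_eq_sum_mul ω ωp hωp ωn hωn hω hαu hβu hvq, two_mul w, Finset.sum_range_add,
    ← Finset.sum_add_distrib, ← two_mul w, sum_Icc_one_eq_sum_range, Finset.mul_sum]
  · refine Finset.sum_congr rfl fun i _ => ?_
    rw [hpair, hconj, ← mul_add, Complex.add_conj]
    have hg := hgauss ((ωp : ZMod p) ^ i * (t : ZMod p))
    have hre := Complex.re_add_im (gaussG p (r * w) ((ωp : ZMod p) ^ i * (t : ZMod p)))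
    rw [show ∀ x y : ℂ, x - 1 + Complex.I * y = x + y * Complex.I - 1 by intros; ring, hre, hg]
    have hr0 : (r : ℂ) ≠ 0 := Nat.cast_ne_zero.2 hr.ne'
    have hw0 : (w : ℂ) ≠ 0 := Nat.cast_ne_zero.2 hw.ne'
    push_cast
    field_simp
    ring
  · have hp0 := hpair 0
    have hn0 := hconj 0
    rw [add_zero] at hp0 hn0
    rw [hgauss, hgauss, hp0, hn0, Complex.conj_re]
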